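/- For every l ≥ 0, the numbers of even involutions avoiding both patterns 132 and 1234 of lengths 4l+1, 4l+2, 4l+3, 4l+4 are, respectively, F_{4l}, F_{4l+1}, F_{4l+1}, F_{4l+2}, where F is the Fibonacci sequence normalized by F_0 = F_1 = 1 and F_n = F_{n−1} + F_{n−2}. -/

import Mathlib

open Finset

/-- The number of occurrences of the pattern `τ` (of length `k`) in the
permutation `π` (of length `n`): the number of strictly increasing index
sequences along which `π` is order-isomorphic to `τ`. -/
def occ {k n : ℕ} (τ : Equiv.Perm (Fin k)) (π : Equiv.Perm (Fin n)) : ℕ :=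
  (Finset.univ.filter (fun f : Fin k → Fin n =>
    (∀ a b : Fin k, a < b → f a < f b) ∧
    (∀ a b : Fin k, τ a < τ b ↔ π (f a) < π (f b)))).card

/-- The number of inversions of a permutation: pairs `i < j` with `π i > π j`. -/
def inversions {n : ℕ} (π : Equiv.Perm (Fin n)) : ℕ :=
  (Finset.univ.filter (fun p : Fin n × Fin n => p.1 < p.2 ∧ π p.2 < π p.1)).card

/-- The number of fixed points of a permutation. -/
def fixedPointCount {n : ℕ} (π : Equiv.Perm (Fin n)) : ℕ :=
  (Finset.univ.filter (fun j : Fin n => π j = j)).card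

/-- The pattern `132` as a permutation of `Fin 3` (zero-indexed values `0,2,1`). -/
def p132 : Equiv.Perm (Fin 3) := Equiv.swap 1 2

/-- The Fibonacci sequence normalized by F 0 = F 1 = 1. -/
def F : ℕ → ℕ
  | 0 => 1
  | 1 => 1
  | n + 2 => F (n + 1) + F n

/-- Number of even involutions of length n avoiding both 132 and 1234. -/
def cntEven (n : ℕ) : ℕ :=
  (Finset.univ.filter (fun π : Equiv.Perm (Fin n) =>
    (∀ i, π (π i) = i) ∧ occ p132 π = 0 ∧ occ (1 : Equiv.Perm (Fin 4)) π = 0 ∧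
      Even (inversions π))).card

/-- Direct form of avoiding 132. -/
def Av3 {n : ℕ} (π : Equiv.Perm (Fin n)) : Prop :=
  ∀ i j k : Fin n, i < j → j < k → π i < π k → π k < π j → False

/-- Direct form of avoiding 1234. -/
def Av4 {n : ℕ} (π : Equiv.Perm (Fin n)) : Prop :=
  ∀ i j k l : Fin n, i < j → j < k → k < l → π i < π j → π j < π k → π k < π l → False

/-- Involutions avoiding both patterns. -/
def Good {n : ℕ} (π : Equiv.Perm (Fin n)) : Prop :=
  (∀ i, π (π i) = i) ∧ Av3 π ∧ Av4 π

/-- The last two entries form an ascent. -/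
def Asc {n : ℕ} (π : Equiv.Perm (Fin n)) : Prop :=
  ∀ i j : Fin n, i.val + 2 = n → j.val + 1 = n → π i < π j

instance {n : ℕ} : DecidablePred (Av3 (n := n)) := fun π => by unfold Av3; infer_instance
instance {n : ℕ} : DecidablePred (Av4 (n := n)) := fun π => by unfold Av4; infer_instance
instance {n : ℕ} : DecidablePred (Good (n := n)) := fun π => by unfold Good; infer_instance
instance {n : ℕ} : DecidablePred (Asc (n := n)) := fun π => by unfold Asc; infer_instance

theorem av3_iff {n : ℕ} (π : Equiv.Perm (Fin n)) : occ p132 π = 0 ↔ Av3 π := by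
  unfold occ Av3
  rw [Finset.card_eq_zero, Finset.filter_eq_empty_iff]
  constructor
  · intro h i j k hij hjk hik hkj
    apply @h ![i, j, k] (Finset.mem_univ _)
    have hik' := hij.trans hjk
    have h13 := hik.trans hkj
    constructor
    · intro a b hab
      fin_cases a <;> fin_cases b <;> simp_all
    · intro a b
      fin_cases a <;> fin_cases b <;>
        simp [p132, Equiv.swap_apply_def, hik, hkj, h13, hik.le, hkj.le, h13.le]
  · rintro h f - ⟨h1, h2⟩
    refine h (f 0) (f 1) (f 2) (h1 _ _ (by decide)) (h1 _ _ (by decide)) ?_ ?_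
    · exact (h2 0 2).1 (by decide)
    · exact (h2 2 1).1 (by decide)

theorem av4_iff {n : ℕ} (π : Equiv.Perm (Fin n)) :
    occ (1 : Equiv.Perm (Fin 4)) π = 0 ↔ Av4 π := by
  unfold occ Av4
  rw [Finset.card_eq_zero, Finset.filter_eq_empty_iff]
  constructor
  · intro h i j k l hij hjk hkl h1 h2 h3
    apply @h ![i, j, k, l] (Finset.mem_univ _)
    have a1 := hij.trans hjk
    have a2 := hjk.trans hkl
    have a3 := a1.trans hkl
    have b1 := h1.trans h2
    have b2 := h2.trans h3
    have b3 := b1.trans h3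
    constructor
    · intro a b hab
      fin_cases a <;> fin_cases b <;> simp_all
    · intro a b
      fin_cases a <;> fin_cases b <;>
        simp [h1, h2, h3, b1, b2, b3, h1.le, h2.le, h3.le, b1.le, b2.le, b3.le]
  · rintro h f - ⟨h1, h2⟩
    refine h (f 0) (f 1) (f 2) (f 3) (h1 _ _ (by decide)) (h1 _ _ (by decide))
      (h1 _ _ (by decide)) ?_ ?_ ?_
    · exact (h2 0 1).1 (by decide)
    · exact (h2 1 2).1 (by decide)
    · exact (h2 2 3).1 (by decide)

theorem even_iff_sign {n : ℕ} (π : Equiv.Perm (Fin n)) :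
    Even (inversions π) ↔ Equiv.Perm.sign π = 1 := by
  have : Equiv.Perm.sign π = (-1) ^ inversions π := by
    rw [Equiv.Perm.sign_eq_prod_prod_Iio, Finset.prod_sigma']
    unfold inversions
    rw [Finset.prod_ite]
    simp only [Finset.prod_const_one, one_mul, Finset.prod_const]
    congr 1
    refine Finset.card_bij (fun x _ => (x.2, x.1)) ?_ ?_ ?_
    · rintro ⟨a, b⟩ h
      simp only [Finset.mem_filter, Finset.mem_sigma, Finset.mem_univ, Finset.mem_Iio, true_and,
        not_lt] at h ⊢
      exact ⟨h.1, lt_of_le_of_ne h.2 (fun h' => h.1.ne' (π.injective h'))⟩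
    · rintro ⟨a, b⟩ _ ⟨c, d⟩ _ h
      simp only [Prod.mk.injEq] at h
      obtain ⟨rfl, rfl⟩ := h
      rfl
    · rintro ⟨a, b⟩ h
      simp only [Finset.mem_filter, Finset.mem_univ, true_and] at h
      refine ⟨⟨b, a⟩, ?_, rfl⟩
      simp [h.1, h.2.le]
  rw [this]
  exact (neg_one_pow_eq_one_iff_even (by decide)).symm

/-- The order embedding with range the complement of `{0, v + 1}`. -/
def emb {m : ℕ} (v : Fin (m + 1)) : Fin m ↪ Fin (m + 2) :=
  ⟨fun j => (v.succAbove j).succ, fun a b h => by simpa using h⟩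

theorem emb_apply {m : ℕ} (v : Fin (m + 1)) (a : Fin m) :
    emb v a = (v.succAbove a).succ := rfl

theorem emb_lt {m : ℕ} (v : Fin (m + 1)) (a b : Fin m) : emb v a < emb v b ↔ a < b := by
  simp [emb_apply]

theorem emb_ne_zero {m : ℕ} (v : Fin (m + 1)) (a : Fin m) : emb v a ≠ 0 := by
  simp [emb_apply]

theorem emb_ne {m : ℕ} (v : Fin (m + 1)) (a : Fin m) : emb v a ≠ v.succ := by
  simp [emb_apply]

theorem cover {m : ℕ} (v : Fin (m + 1)) (i : Fin (m + 2)) :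
    i = 0 ∨ i = v.succ ∨ ∃ a, i = emb v a := by
  rcases Fin.eq_zero_or_eq_succ i with h | ⟨j, rfl⟩
  · exact Or.inl h
  · right
    by_cases h : j = v
    · left; rw [h]
    · right
      obtain ⟨a, rfl⟩ := Fin.exists_succAbove_eq h
      exact ⟨a, rfl⟩

/-- Insert the 2-cycle `(0, v + 1)` in `σ`. -/
def ins {m : ℕ} (v : Fin (m + 1)) (σ : Equiv.Perm (Fin m)) : Equiv.Perm (Fin (m + 2)) :=
  Equiv.swap 0 v.succ * σ.viaFintypeEmbedding (emb v)

theorem ins_emb {m : ℕ} (v : Fin (m + 1)) (σ : Equiv.Perm (Fin m)) (a : Fin m) :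
    ins v σ (emb v a) = emb v (σ a) := by
  simp only [ins, Equiv.Perm.mul_apply, Equiv.Perm.viaFintypeEmbedding_apply_image]
  exact Equiv.swap_apply_of_ne_of_ne (emb_ne_zero _ _) (emb_ne _ _)

theorem ins_zero {m : ℕ} (v : Fin (m + 1)) (σ : Equiv.Perm (Fin m)) :
    ins v σ 0 = v.succ := by
  rw [ins, Equiv.Perm.mul_apply, Equiv.Perm.viaFintypeEmbedding_apply_notMem_range,
    Equiv.swap_apply_left]
  rintro ⟨a, h⟩
  exact emb_ne_zero _ _ h

theorem ins_succ {m : ℕ} (v : Fin (m + 1)) (σ : Equiv.Perm (Fin m)) :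
    ins v σ v.succ = 0 := by
  rw [ins, Equiv.Perm.mul_apply, Equiv.Perm.viaFintypeEmbedding_apply_notMem_range,
    Equiv.swap_apply_right]
  rintro ⟨a, h⟩
  exact emb_ne _ _ h

theorem ins_sign {m : ℕ} (v : Fin (m + 1)) (σ : Equiv.Perm (Fin m)) :
    Equiv.Perm.sign (ins v σ) = - Equiv.Perm.sign σ := by
  rw [ins, Equiv.Perm.sign_mul, Equiv.Perm.viaFintypeEmbedding_sign,
    Equiv.Perm.sign_swap (Fin.succ_ne_zero v).symm]
  simp

theorem ins_injective {m : ℕ} (v : Fin (m + 1)) : Function.Injective (ins (m := m) v) := by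
  intro σ τ h
  ext1 a
  apply (emb v).injective
  rw [← ins_emb, ← ins_emb, h]

theorem ins_invol {m : ℕ} (v : Fin (m + 1)) (σ : Equiv.Perm (Fin m)) :
    (∀ i, ins v σ (ins v σ i) = i) ↔ ∀ i, σ (σ i) = i := by
  constructor
  · intro h i
    apply (emb v).injective
    rw [← ins_emb, ← ins_emb, h]
  · intro h i
    rcases cover v i with rfl | rfl | ⟨a, rfl⟩
    · rw [ins_zero, ins_succ]
    · rw [ins_succ, ins_zero]
    · rw [ins_emb, ins_emb, h]

theorem exists_ins {m : ℕ} (v : Fin (m + 1)) (π : Equiv.Perm (Fin (m + 2)))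
    (h : ∀ i, π (π i) = i) (h0 : π 0 = v.succ) : ∃ σ, ins v σ = π := by
  have hv : π v.succ = 0 := by rw [← h0, h]
  have key : ∀ a, ∃ b, π (emb v a) = emb v b := by
    intro a
    rcases cover v (π (emb v a)) with h1 | h1 | h1
    · rw [← hv] at h1
      exact absurd (π.injective h1) (emb_ne _ _)
    · rw [← h0] at h1
      exact absurd (π.injective h1) (emb_ne_zero _ _)
    · exact h1
  choose f hf using key
  have hinv : Function.Involutive f := by
    intro a
    apply (emb v).injective
    rw [← hf, ← hf, h]
  refine ⟨hinv.toPerm, ?_⟩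
  ext1 i
  rcases cover v i with rfl | rfl | ⟨a, rfl⟩
  · rw [ins_zero, h0]
  · rw [ins_succ, hv]
  · rw [ins_emb, hf]; rfl

theorem av3_of_ins {m : ℕ} (v : Fin (m + 1)) (σ : Equiv.Perm (Fin m)) (h : Av3 (ins v σ)) :
    Av3 σ := by
  intro i j k h1 h2 h3 h4
  refine h (emb v i) (emb v j) (emb v k) ?_ ?_ ?_ ?_ <;> simp only [ins_emb, emb_lt] <;> assumption

theorem av4_of_ins {m : ℕ} (v : Fin (m + 1)) (σ : Equiv.Perm (Fin m)) (h : Av4 (ins v σ)) :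
    Av4 σ := by
  intro i j k l h1 h2 h3 h4 h5 h6
  refine h (emb v i) (emb v j) (emb v k) (emb v l) ?_ ?_ ?_ ?_ ?_ ?_ <;>
    simp only [ins_emb, emb_lt] <;> assumption

theorem av4_ins {m : ℕ} (v : Fin (m + 1)) (hv : m ≤ v.val + 2) (σ : Equiv.Perm (Fin m))
    (h : Av4 σ) : Av4 (ins v σ) := by
  intro i j k l h1 h2 h3 h4 h5 h6
  have hs : v.succ.val = v.val + 1 := rfl
  have step : ∀ x y : Fin (m + 2), x < y → ins v σ x < ins v σ y → ∃ b, y = emb v b := by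
    intro x y hxy hxy'
    rcases cover v y with rfl | rfl | hb
    · exact absurd hxy (Fin.not_lt_zero x)
    · rw [ins_succ] at hxy'
      exact absurd hxy' (Fin.not_lt_zero _)
    · exact hb
  obtain ⟨b, rfl⟩ := step _ _ h1 h4
  obtain ⟨c, rfl⟩ := step _ _ h2 h5
  obtain ⟨d, rfl⟩ := step _ _ h3 h6
  rcases cover v i with rfl | rfl | ⟨a, rfl⟩
  · rw [ins_zero] at h4
    simp only [Fin.lt_def] at h4 h5 h6
    have := (ins v σ (emb v d)).isLt
    omega
  · simp only [Fin.lt_def] at h1 h2 h3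
    have := (emb v d).isLt
    omega
  · simp only [ins_emb, emb_lt] at h1 h2 h3 h4 h5 h6
    exact h a b c d h1 h2 h3 h4 h5 h6

theorem av3_ins {m : ℕ} (v : Fin (m + 1)) (hv : m ≤ v.val + 2) (σ : Equiv.Perm (Fin m))
    (hi : ∀ i, σ (σ i) = i) (h : Av3 σ) (ha : v.val + 2 = m → Asc (ins v σ)) :
    Av3 (ins v σ) := by
  intro i j k h1 h2 h3 h4
  have hs : v.succ.val = v.val + 1 := rfl
  have step : ∀ x y : Fin (m + 2), x < y → ins v σ x < ins v σ y → ∃ b, y = emb v b := by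
    intro x y hxy hxy'
    rcases cover v y with rfl | rfl | hb
    · exact absurd hxy (Fin.not_lt_zero x)
    · rw [ins_succ] at hxy'
      exact absurd hxy' (Fin.not_lt_zero _)
    · exact hb
  have hI := (ins_invol v σ).2 hi
  rcases cover v i with rfl | rfl | ⟨a, rfl⟩
  · rw [ins_zero] at h3
    simp only [Fin.lt_def] at h3 h4
    have b1 := (ins v σ j).isLt
    have := ha (by omega) (ins v σ k) (ins v σ j) (by omega) (by omega)
    rw [hI, hI] at this
    exact absurd (this.trans h2) (lt_irrefl _)
  · have hk := k.isLt
    rw [Fin.lt_def] at h1 h2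
    have := ha (by omega) j k (by omega) (by omega)
    exact absurd (this.trans h4) (lt_irrefl _)
  · obtain ⟨b, rfl⟩ := step _ _ h1 (h3.trans h4)
    obtain ⟨c, rfl⟩ := step _ _ (h1.trans h2) h3
    simp only [ins_emb, emb_lt] at h1 h2 h3 h4
    exact h a b c h1 h2 h3 h4

theorem good_ins {m : ℕ} (v : Fin (m + 1)) (hv : m ≤ v.val + 1) (σ : Equiv.Perm (Fin m)) :
    Good (ins v σ) ↔ Good σ := by
  constructor
  · rintro ⟨h1, h2, h3⟩
    exact ⟨(ins_invol v σ).1 h1, av3_of_ins v σ h2, av4_of_ins v σ h3⟩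
  · rintro ⟨h1, h2, h3⟩
    exact ⟨(ins_invol v σ).2 h1, av3_ins v (by omega) σ h1 h2 (by omega),
      av4_ins v (by omega) σ h3⟩

theorem asc_ins {m : ℕ} (v : Fin (m + 1)) (hv : v.val + 2 = m) (σ : Equiv.Perm (Fin m)) :
    Asc (ins v σ) ↔ Asc σ := by
  have he : ∀ a : Fin m, v.val ≤ a.val → (emb v a).val = a.val + 2 := by
    intro a h
    show ((v.succAbove a).succ).val = _
    rw [Fin.succAbove_of_le_castSucc _ _ (by rw [Fin.le_def]; exact h)]
    simp
  constructor
  · intro h i j hi hj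
    have := h (emb v i) (emb v j) (by rw [he i (by omega)]; omega) (by rw [he j (by omega)]; omega)
    rwa [ins_emb, ins_emb, emb_lt] at this
  · intro h i j hi hj
    have h1 : i = emb v ⟨m - 2, by omega⟩ := by
      apply Fin.ext; rw [he _ (by show _ ≤ m - 2; omega)]; show _ = m - 2 + 2; omega
    have h2 : j = emb v ⟨m - 1, by omega⟩ := by
      apply Fin.ext; rw [he _ (by show _ ≤ m - 1; omega)]; show _ = m - 1 + 2; omega
    have key : ins v σ (emb v ⟨m - 2, by omega⟩) < ins v σ (emb v ⟨m - 1, by omega⟩) := by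
      rw [ins_emb, ins_emb, emb_lt]
      exact h _ _ (by show m - 2 + 2 = m; omega) (by show m - 1 + 1 = m; omega)
    exact lt_of_eq_of_lt (congrArg _ h1) (lt_of_lt_of_eq key (congrArg _ h2).symm)

theorem good_asc {m : ℕ} (v : Fin (m + 1)) (hv : v.val + 2 = m)
    (π : Equiv.Perm (Fin (m + 2))) (h0 : π 0 = v.succ) (h : Good π) : Asc π := by
  intro i j hi hj
  obtain ⟨hI, h3, h4⟩ := h
  have hs : v.succ.val = v.val + 1 := rfl
  by_contra hc
  have hne : π i ≠ π j := fun h => by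
    have := congrArg Fin.val (π.injective h)
    omega
  have hlt : π j < π i := lt_of_le_of_ne (not_lt.1 hc) hne.symm
  refine h3 0 (π j) (π i) ?_ hlt ?_ ?_
  · rw [Fin.pos_iff_ne_zero]
    intro h
    have := hI j
    rw [h, h0] at this
    have := congrArg Fin.val this
    omega
  · rw [hI, h0, Fin.lt_def]; omega
  · rw [hI, hI, Fin.lt_def]; omega

theorem good_ins' {m : ℕ} (v : Fin (m + 1)) (hv : v.val + 2 = m) (σ : Equiv.Perm (Fin m)) :
    Good (ins v σ) ↔ Good σ ∧ Asc σ := by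
  constructor
  · intro h
    have ha := (asc_ins v hv σ).1 (good_asc v hv _ (ins_zero v σ) h)
    obtain ⟨h1, h2, h3⟩ := h
    exact ⟨⟨(ins_invol v σ).1 h1, av3_of_ins v σ h2, av4_of_ins v σ h3⟩, ha⟩
  · rintro ⟨⟨h1, h2, h3⟩, ha⟩
    exact ⟨(ins_invol v σ).2 h1, av3_ins v (by omega) σ h1 h2 (fun _ => (asc_ins v hv σ).2 ha),
      av4_ins v (by omega) σ h3⟩

theorem good_first {k : ℕ} (π : Equiv.Perm (Fin (k + 4))) (h : Good π) : k + 1 ≤ (π 0).val := by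
  obtain ⟨hI, h3, h4⟩ := h
  by_contra hc
  have key : ∀ x y : Fin (k + 4), π 0 < x → x < y → π x < π y := by
    intro x y hx hxy
    by_contra hlt
    have hne : π x ≠ π y := fun h => hxy.ne (π.injective h)
    refine h3 0 (π y) (π x) ?_ (lt_of_le_of_ne (not_lt.1 hlt) hne.symm) ?_ ?_
    · rw [Fin.pos_iff_ne_zero]
      intro h
      have := hI y
      rw [h] at this
      exact absurd (this ▸ hx.trans hxy) (lt_irrefl _)
    · rwa [hI]
    · rwa [hI, hI]
  have hpos : ∀ x : Fin (k + 4), π 0 < x → 0 < π x := by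
    intro x hx
    rw [Fin.pos_iff_ne_zero]
    intro h
    have := hI x
    rw [h] at this
    exact absurd (this ▸ hx) (lt_irrefl _)
  have e1 : π 0 < (⟨k + 1, by omega⟩ : Fin (k + 4)) := by rw [Fin.lt_def]; show _ < k + 1; omega
  have e2 : (⟨k + 1, by omega⟩ : Fin (k + 4)) < ⟨k + 2, by omega⟩ := by simp
  have e3 : (⟨k + 2, by omega⟩ : Fin (k + 4)) < ⟨k + 3, by omega⟩ := by simp
  refine h4 0 _ _ _ (hpos _ e1) (key _ _ e1 e2) (key _ _ (e1.trans e2) e3) ?_ ?_ ?_ <;>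
    simpa only [hI]

/-- Signed count. -/
def T (n : ℕ) (s : ℤˣ) : ℕ :=
  (Finset.univ.filter (fun π : Equiv.Perm (Fin n) => Good π ∧ Equiv.Perm.sign π = s)).card

/-- Signed count with final ascent. -/
def U (n : ℕ) (s : ℤˣ) : ℕ :=
  (Finset.univ.filter (fun π : Equiv.Perm (Fin n) =>
    (Good π ∧ Asc π) ∧ Equiv.Perm.sign π = s)).card

theorem card_ins {m : ℕ} (v : Fin (m + 1)) (s : ℤˣ)
    (P : Equiv.Perm (Fin (m + 2)) → Prop) (Q : Equiv.Perm (Fin m) → Prop)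
    [DecidablePred P] [DecidablePred Q]
    (hP : ∀ π, P π → ∀ i, π (π i) = i) (hPQ : ∀ σ, P (ins v σ) ↔ Q σ) :
    (Finset.univ.filter (fun π => (P π ∧ Equiv.Perm.sign π = s) ∧ π 0 = v.succ)).card =
    (Finset.univ.filter (fun σ => Q σ ∧ Equiv.Perm.sign σ = -s)).card := by
  rw [← Finset.card_image_of_injective _ (ins_injective v)]
  congr 1
  ext π
  simp only [Finset.mem_filter, Finset.mem_univ, true_and, Finset.mem_image]
  constructor
  · rintro ⟨⟨h1, h2⟩, h3⟩
    obtain ⟨σ, rfl⟩ := exists_ins v π (hP π h1) h3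
    refine ⟨σ, ⟨(hPQ σ).1 h1, ?_⟩, rfl⟩
    rw [ins_sign] at h2
    rw [← h2, neg_neg]
  · rintro ⟨σ, ⟨h1, h2⟩, rfl⟩
    refine ⟨⟨(hPQ σ).2 h1, ?_⟩, ins_zero v σ⟩
    rw [ins_sign, h2, neg_neg]

theorem split {k : ℕ} (P : Equiv.Perm (Fin (k + 4)) → Prop) [DecidablePred P]
    (hP : ∀ π, P π → Good π) :
    (Finset.univ.filter P).card =
    (Finset.univ.filter (fun π => P π ∧ π 0 = (⟨k + 2, by omega⟩ : Fin (k + 3)).succ)).card +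
    (Finset.univ.filter (fun π => P π ∧ π 0 = (⟨k + 1, by omega⟩ : Fin (k + 3)).succ)).card +
    (Finset.univ.filter (fun π => P π ∧ π 0 = (⟨k, by omega⟩ : Fin (k + 3)).succ)).card := by
  rw [← Finset.card_union_of_disjoint, ← Finset.card_union_of_disjoint]
  · congr 1
    ext π
    simp only [Finset.mem_filter, Finset.mem_univ, true_and, Finset.mem_union, Fin.ext_iff,
      Fin.val_succ]
    constructor
    · intro h
      have h1 := good_first π (hP π h)
      have h2 := (π 0).isLt
      rcases (by omega : (π 0).val = k + 2 + 1 ∨ (π 0).val = k + 1 + 1 ∨ (π 0).val = k + 1)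
        with h3 | h3 | h3 <;> simp [h, h3]
    · rintro ((h | h) | h) <;> exact h.1
  · rw [Finset.disjoint_left]
    intro π
    simp only [Finset.mem_filter, Finset.mem_univ, true_and, Finset.mem_union, Fin.ext_iff,
      Fin.val_succ]
    omega
  · rw [Finset.disjoint_left]
    intro π
    simp only [Finset.mem_filter, Finset.mem_univ, true_and, Fin.ext_iff,
      Fin.val_succ]
    omega

theorem T_rec (k : ℕ) (s : ℤˣ) : T (k + 4) s = 2 * T (k + 2) (-s) + U (k + 2) (-s) := by
  unfold T U
  rw [split _ (fun π h => h.1), card_ins _ s Good Good (fun π h => h.1) (good_ins _ (by simp)),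
    card_ins _ s Good Good (fun π h => h.1) (good_ins _ (by simp)),
    card_ins _ s Good (fun σ => Good σ ∧ Asc σ) (fun π h => h.1) (good_ins' _ (by simp))]
  ring

theorem U_rec (k : ℕ) (s : ℤˣ) : U (k + 4) s = T (k + 2) (-s) + U (k + 2) (-s) := by
  unfold T U
  rw [split _ (fun π h => h.1.1),
    card_ins _ s (fun π => Good π ∧ Asc π) (fun _ => False) (fun π h => h.1.1),
    card_ins _ s (fun π => Good π ∧ Asc π) Good (fun π h => h.1.1),
    card_ins _ s (fun π => Good π ∧ Asc π) (fun σ => Good σ ∧ Asc σ) (fun π h => h.1.1)]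
  · simp
  · intro σ
    rw [good_ins' _ (by simp), asc_ins _ (by simp)]
    tauto
  · intro σ
    rw [good_ins _ (by simp)]
    refine ⟨fun h => h.1, fun h => ⟨h, ?_⟩⟩
    intro i j hi hj
    have h1 : i = (⟨k + 1, by omega⟩ : Fin (k + 3)).succ := by
      apply Fin.ext; rw [Fin.val_succ]; show _ = k + 1 + 1; omega
    rw [h1, ins_succ, Fin.pos_iff_ne_zero, ← ins_succ _ σ]
    intro h
    have := congrArg Fin.val ((ins _ σ).injective h)
    simp at this
    omega
  · intro σ
    simp only [iff_false]
    rintro ⟨_, h⟩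
    have := h ⟨k + 2, by omega⟩ (⟨k + 2, by omega⟩ : Fin (k + 3)).succ rfl rfl
    rw [ins_succ] at this
    exact absurd this (Fin.not_lt_zero _)

theorem cnt_eq (n : ℕ) : cntEven n = T n 1 := by
  unfold cntEven T Good
  congr 1
  ext π
  simp only [Finset.mem_filter, av3_iff, av4_iff, even_iff_sign, and_assoc]

theorem T_rec4 (k : ℕ) : T (k + 6) 1 = 5 * T (k + 2) 1 + 3 * U (k + 2) 1 := by
  rw [show k + 6 = (k + 2) + 4 from rfl, T_rec, show k + 2 + 2 = k + 4 from rfl, T_rec, U_rec,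
    neg_neg]
  ring

theorem U_rec4 (k : ℕ) : U (k + 6) 1 = 3 * T (k + 2) 1 + 2 * U (k + 2) 1 := by
  rw [show k + 6 = (k + 2) + 4 from rfl, U_rec, show k + 2 + 2 = k + 4 from rfl, T_rec, U_rec,
    neg_neg]
  ring

theorem base2 : T 2 1 = 1 ∧ U 2 1 = 1 ∧ T 2 (-1) = 1 ∧ U 2 (-1) = 0 := by decide

theorem base3 : T 3 1 = 1 ∧ U 3 1 = 1 ∧ T 3 (-1) = 2 ∧ U 3 (-1) = 1 := by decide

theorem F_add (n : ℕ) : F (n + 2) = F (n + 1) + F n := rfl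

theorem main_aux (l : ℕ) :
    (T (4 * l + 2) 1 = F (4 * l + 1) ∧ U (4 * l + 2) 1 = F (4 * l)) ∧
    (T (4 * l + 3) 1 = F (4 * l + 1) ∧ U (4 * l + 3) 1 = F (4 * l)) ∧
    (T (4 * l + 4) 1 = F (4 * l + 2) ∧ U (4 * l + 4) 1 = F (4 * l + 1)) ∧
    (T (4 * l + 5) 1 = F (4 * l + 4) ∧ U (4 * l + 5) 1 = F (4 * l + 3)) := by
  induction l with
  | zero =>
    obtain ⟨a1, a2, a3, a4⟩ := base2
    obtain ⟨b1, b2, b3, b4⟩ := base3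
    have c1 := T_rec 0 1
    have c2 := U_rec 0 1
    have c3 := T_rec 1 1
    have c4 := U_rec 1 1
    simp only [Nat.reduceAdd] at c1 c2 c3 c4
    simp only [Nat.mul_zero, Nat.zero_add, c1, c2, c3, c4, a1, a2, a3, a4, b1, b2, b3, b4]
    decide
  | succ l ih =>
    obtain ⟨⟨a1, a2⟩, ⟨b1, b2⟩, ⟨c1, c2⟩, d1, d2⟩ := ih
    have t0 := T_rec4 (4 * l)
    have t1 := T_rec4 (4 * l + 1)
    have t2 := T_rec4 (4 * l + 2)
    have t3 := T_rec4 (4 * l + 3)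
    have u0 := U_rec4 (4 * l)
    have u1 := U_rec4 (4 * l + 1)
    have u2 := U_rec4 (4 * l + 2)
    have u3 := U_rec4 (4 * l + 3)
    have f0 := F_add (4 * l)
    have f1 := F_add (4 * l + 1)
    have f2 := F_add (4 * l + 2)
    have f3 := F_add (4 * l + 3)
    have f4 := F_add (4 * l + 4)
    have f5 := F_add (4 * l + 5)
    have f6 := F_add (4 * l + 6)
    simp only [Nat.add_assoc, Nat.reduceAdd, Nat.mul_add, Nat.mul_one] at *
    omega

/-- Counts of even involutions avoiding 132 and 1234 of lengths
4l+1, 4l+2, 4l+3, 4l+4 are F(4l), F(4l+1), F(4l+1), F(4l+2). -/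
theorem even_involutions_avoiding_132_1234 (l : ℕ) :
    cntEven (4 * l + 1) = F (4 * l) ∧
    cntEven (4 * l + 2) = F (4 * l + 1) ∧
    cntEven (4 * l + 3) = F (4 * l + 1) ∧
    cntEven (4 * l + 4) = F (4 * l + 2) := by
  simp only [cnt_eq]
  obtain ⟨⟨a1, a2⟩, ⟨b1, b2⟩, ⟨c1, c2⟩, d1, d2⟩ := main_aux l
  refine ⟨?_, a1, b1, c1⟩
  cases l with
  | zero => decide
  | succ l => exact (main_aux l).2.2.2.1
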